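/- Let b ≥ 0 be an integer and let X be a real number with X ≠ p. Then F_p(b+2,b+2;X) − F_p(b+2,b;X) = (X^{b+1}·(X+p)·(X−1)/(X−p)) · ( ((1 + p − p²)X − p)·p^{b+1} + ((p² − X)/p)·X^{b+3} ). -/

import Mathlib

/-- The symbol `[u,v]` of Hironaka, for integers `u ≥ v ≥ 0`. -/
noncomputable def bsym (p u v : ℕ) : ℚ :=
  (∏ i ∈ Finset.Icc 1 u, (1 - (-(p : ℚ))⁻¹ ^ i)) /
    ((∏ i ∈ Finset.Icc 1 v, (1 - (-(p : ℚ))⁻¹ ^ i)) *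
      (∏ i ∈ Finset.Icc 1 (u - v), (1 - (-(p : ℚ))⁻¹ ^ i)))

/-- For a pair `a = (a₁, a₂)`, the quantity `a'_i = #{j ∈ {1,2} : a_j ≥ i}`. -/
def dualCt (a : ℕ × ℕ) (i : ℕ) : ℕ :=
  (if i ≤ a.1 then 1 else 0) + (if i ≤ a.2 then 1 else 0)

/-- Hironaka's local factor `I_j(μ, λ)`, for pairs `μ = (c,d)`, `λ = (λ₁,λ₂)`. -/
noncomputable def hirI (p : ℕ) (μ lam : ℕ × ℕ) (j : ℕ) : ℚ :=
  ∑ i ∈ Finset.Icc (dualCt μ (j + 1))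
      (min (dualCt (lam.1 + 1, lam.2 + 1) (j + 1)) (dualCt μ j)),
    (-(p : ℚ)) ^ (i * (2 * dualCt (lam.1 + 1, lam.2 + 1) (j + 1) + 1 - i) / 2) *
      bsym p (dualCt (lam.1 + 1, lam.2 + 1) (j + 1) - dualCt μ (j + 1))
        (dualCt (lam.1 + 1, lam.2 + 1) (j + 1) - i) *
      bsym p (dualCt (lam.1 + 1, lam.2 + 1) j - i)
        (dualCt (lam.1 + 1, lam.2 + 1) j - dualCt μ j)

/-- `ε_n = 0` if `n = 0` and `1` otherwise. -/
def epsn (n : ℕ) : ℕ := if n = 0 then 0 else 1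

/-- The specialization `F_p(a,b;X)` of Hironaka's formula for Hermitian representation
densities: `α(diag(p,1) ⊕ 1_r, diag(p^a, p^b)) = F_p(a,b;(-p)^{-r})`. -/
noncomputable def Fp (p a b : ℕ) (X : ℝ) : ℝ :=
  ∑ c ∈ Finset.range (a + 2), ∑ d ∈ Finset.range (min c (b + 1) + 1),
    (-1 : ℝ) ^ d * ((p : ℝ) ^ (2 * d + c))⁻¹ * X ^ (c + d) *
      (-(p : ℝ)) ^ (epsn c + epsn d) *
      ∏ j ∈ Finset.Icc 1 (a + 1), ((hirI p (c, d) (a, b) j : ℚ) : ℝ)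

lemma one_sub_neg_inv_pow_ne_zero {p : ℕ} (hp : 2 ≤ p) {i : ℕ} (hi : i ≠ 0) :
    (1 - (-(p : ℚ))⁻¹ ^ i) ≠ 0 := by
  intro h
  have h1 : |(-(p : ℚ))⁻¹ ^ i| = 1 := by rw [← sub_eq_zero.mp h, abs_one]
  have hp' : (1 : ℚ) < p := by exact_mod_cast hp
  rw [abs_pow, abs_inv, abs_neg, Nat.abs_cast] at h1
  exact (pow_lt_one₀ (by positivity) (inv_lt_one_of_one_lt₀ hp') hi).ne h1

lemma prod_one_sub_neg_inv_pow_ne_zero {p : ℕ} (hp : 2 ≤ p) (u : ℕ) :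
    ∏ i ∈ Finset.Icc 1 u, (1 - (-(p : ℚ))⁻¹ ^ i) ≠ 0 :=
  Finset.prod_ne_zero_iff.mpr fun i hi =>
    one_sub_neg_inv_pow_ne_zero hp (by rw [Finset.mem_Icc] at hi; omega)

lemma bsym_self {p : ℕ} (hp : 2 ≤ p) (u : ℕ) : bsym p u u = 1 := by
  have h := prod_one_sub_neg_inv_pow_ne_zero hp u
  rw [bsym]
  simp only [Nat.sub_self, zero_lt_one, Finset.Icc_eq_empty_of_lt, Finset.prod_empty,
    mul_one, div_self h]

lemma bsym_zero {p : ℕ} (hp : 2 ≤ p) (u : ℕ) : bsym p u 0 = 1 := by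
  have h := prod_one_sub_neg_inv_pow_ne_zero hp u
  rw [bsym]
  simp only [Nat.sub_zero, zero_lt_one, Finset.Icc_eq_empty_of_lt, Finset.prod_empty,
    one_mul, div_self h]

lemma bsym_two_one {p : ℕ} (hp : 2 ≤ p) : bsym p 2 1 = 1 + (-(p : ℚ))⁻¹ := by
  have h : (1 - (-(p : ℚ))⁻¹) ≠ 0 := by
    simpa using one_sub_neg_inv_pow_ne_zero hp one_ne_zero
  simp only [bsym, Finset.prod_Icc_succ_top (show 1 ≤ 1 + 1 by norm_num), Finset.Icc_self,
    Finset.prod_singleton, pow_one, Nat.reduceSub, Nat.reduceAdd]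
  rw [div_eq_iff (mul_ne_zero h h)]
  ring

/-- Hironaka's local factor as a function of the four column lengths `A, B` (of the shifted
partition at `j + 1` and `j`) and `C, D` (of `μ` at `j` and `j + 1`) that it depends on. -/
noncomputable def localFactor (p A B C D : ℕ) : ℚ :=
  ∑ i ∈ Finset.Icc D (min A C),
    (-(p : ℚ)) ^ (i * (2 * A + 1 - i) / 2) * bsym p (A - D) (A - i) * bsym p (B - i) (B - C)

lemma hirI_eq_localFactor (p : ℕ) (μ lam : ℕ × ℕ) (j : ℕ) :
    hirI p μ lam j = localFactor p (dualCt (lam.1 + 1, lam.2 + 1) (j + 1))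
      (dualCt (lam.1 + 1, lam.2 + 1) j) (dualCt μ j) (dualCt μ (j + 1)) := rfl

section LocalFactor

variable {p : ℕ} (hp : 2 ≤ p)
include hp

lemma localFactor_zero_zero (A B : ℕ) : localFactor p A B 0 0 = 1 := by
  simp [localFactor, bsym_self hp]

lemma localFactor_2210 : localFactor p 2 2 1 0 = (1 + (-(p : ℚ))⁻¹) * (1 + (-(p : ℚ)) ^ 2) := by
  simp [localFactor, Finset.sum_Icc_succ_top, bsym_self hp, bsym_two_one hp]
  ring

lemma localFactor_2211 : localFactor p 2 2 1 1 = (-(p : ℚ)) ^ 2 := by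
  simp [localFactor, bsym_self hp]

lemma localFactor_2220 : localFactor p 2 2 2 0 = (1 + -(p : ℚ)) * (1 + (-(p : ℚ)) ^ 2) := by
  have hq : (p : ℚ) ≠ 0 := by positivity
  simp [localFactor, Finset.sum_Icc_succ_top, bsym_self hp, bsym_zero hp, bsym_two_one hp]
  field_simp
  ring

lemma localFactor_2221 : localFactor p 2 2 2 1 = (-(p : ℚ)) ^ 2 * (1 + -(p : ℚ)) := by
  simp [localFactor, Finset.sum_Icc_succ_top, bsym_self hp, bsym_zero hp]
  ring

lemma localFactor_2222 : localFactor p 2 2 2 2 = (-(p : ℚ)) ^ 3 := by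
  simp [localFactor, bsym_zero hp]

lemma localFactor_1210 : localFactor p 1 2 1 0 = 1 + (-(p : ℚ))⁻¹ + -(p : ℚ) := by
  simp [localFactor, Finset.sum_Icc_succ_top, bsym_self hp, bsym_zero hp, bsym_two_one hp]

lemma localFactor_1211 : localFactor p 1 2 1 1 = -(p : ℚ) := by
  simp [localFactor, bsym_self hp]

lemma localFactor_1220 : localFactor p 1 2 2 0 = 1 + -(p : ℚ) := by
  simp [localFactor, Finset.sum_Icc_succ_top, bsym_self hp, bsym_zero hp]

lemma localFactor_1221 : localFactor p 1 2 2 1 = -(p : ℚ) := by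
  simp [localFactor, bsym_zero hp]

lemma localFactor_1110 : localFactor p 1 1 1 0 = 1 + -(p : ℚ) := by
  simp [localFactor, Finset.sum_Icc_succ_top, bsym_self hp, bsym_zero hp]

lemma localFactor_1111 : localFactor p 1 1 1 1 = -(p : ℚ) := by
  simp [localFactor, bsym_self hp, bsym_zero hp]

lemma localFactor_0210 : localFactor p 0 2 1 0 = 1 + (-(p : ℚ))⁻¹ := by
  simp [localFactor, bsym_self hp, bsym_two_one hp]

lemma localFactor_0220 : localFactor p 0 2 2 0 = 1 := by
  simp [localFactor, bsym_self hp, bsym_zero hp]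

lemma localFactor_0110 : localFactor p 0 1 1 0 = 1 := by
  simp [localFactor, bsym_self hp, bsym_zero hp]

/-- The factors at `j ≤ n ≤ λ₂` where `j < d` are all equal to `(-p)³`. -/
lemma prod_hirI_of_lt {lam : ℕ × ℕ} {c d n : ℕ} (h1 : n ≤ lam.1) (h2 : n ≤ lam.2) (hdc : d ≤ c)
    (hn : n < d) : ∏ j ∈ Finset.Icc 1 n, hirI p (c, d) lam j = (-(p : ℚ)) ^ (3 * n) := by
  have h : ∀ j ∈ Finset.Icc 1 n, hirI p (c, d) lam j = (-(p : ℚ)) ^ 3 := fun j hj => by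
    rw [Finset.mem_Icc] at hj
    simp (disch := omega) only [hirI_eq_localFactor, dualCt, if_pos, Nat.reduceAdd,
      localFactor_2222 hp]
  rw [Finset.prod_congr rfl h, Finset.prod_const, Nat.card_Icc, Nat.add_sub_cancel, pow_mul]

lemma prod_hirI_zero {lam : ℕ × ℕ} {c n : ℕ} (h1 : n ≤ lam.1) (h2 : n ≤ lam.2) (hn : n < c) :
    ∏ j ∈ Finset.Icc 1 n, hirI p (c, 0) lam j = (-(p : ℚ)) ^ (2 * n) := by
  have h : ∀ j ∈ Finset.Icc 1 n, hirI p (c, 0) lam j = (-(p : ℚ)) ^ 2 := fun j hj => by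
    rw [Finset.mem_Icc] at hj
    simp (disch := omega) only [hirI_eq_localFactor, dualCt, if_pos, if_neg, Nat.reduceAdd,
      localFactor_2211 hp]
  rw [Finset.prod_congr rfl h, Finset.prod_const, Nat.card_Icc, Nat.add_sub_cancel, pow_mul]

lemma prod_hirI_succ {lam : ℕ × ℕ} {c e n : ℕ} (h1 : n ≤ lam.1) (h2 : n ≤ lam.2) (hn : n < c)
    (he : e + 1 ≤ n) :
    ∏ j ∈ Finset.Icc 1 n, hirI p (c, e + 1) lam j =
      (1 + -(p : ℚ)) * (-(p : ℚ)) ^ (2 * n + e) := by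
  induction n, he using Nat.le_induction with
  | base =>
    rw [Finset.prod_Icc_succ_top (by omega),
      prod_hirI_of_lt hp (by omega) (by omega) (by omega) (by omega)]
    simp (disch := omega) only [hirI_eq_localFactor, dualCt, if_pos, if_neg, Nat.reduceAdd,
      localFactor_2221 hp]
    ring
  | succ n he ih =>
    rw [Finset.prod_Icc_succ_top (by omega), ih (by omega) (by omega) (by omega)]
    simp (disch := omega) only [hirI_eq_localFactor, dualCt, if_pos, if_neg, Nat.reduceAdd,
      localFactor_2211 hp]
    ring

/-- The factors of a pair `(c, d)` with `c ≤ b` do not see the part of `λ` beyond `b`. -/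
lemma hirI_congr_of_le {b c d : ℕ} (hc : c ≤ b) (hd : d ≤ c) (j : ℕ) :
    hirI p (c, d) (b + 2, b + 2) j = hirI p (c, d) (b + 2, b) j := by
  rcases le_or_gt j b with hj | hj
  · simp (disch := omega) only [hirI_eq_localFactor, dualCt, if_pos]
  · have hC : dualCt (c, d) j = 0 := by
      simp (disch := omega) only [dualCt, if_neg]
    have hD : dualCt (c, d) (j + 1) = 0 := by
      simp (disch := omega) only [dualCt, if_neg]
    simp only [hirI_eq_localFactor, hC, hD, localFactor_zero_zero hp]

end LocalFactor

/-- The summand of `Fp` at `(c, d)`. -/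
noncomputable def FpTerm (p a b : ℕ) (X : ℝ) (c d : ℕ) : ℝ :=
  (-1 : ℝ) ^ d * ((p : ℝ) ^ (2 * d + c))⁻¹ * X ^ (c + d) * (-(p : ℝ)) ^ (epsn c + epsn d) *
    ∏ j ∈ Finset.Icc 1 (a + 1), ((hirI p (c, d) (a, b) j : ℚ) : ℝ)

lemma Fp_eq_sum_FpTerm (p a b : ℕ) (X : ℝ) :
    Fp p a b X =
      ∑ c ∈ Finset.range (a + 2), ∑ d ∈ Finset.range (min c (b + 1) + 1), FpTerm p a b X c d := rfl

section Terms

variable {p : ℕ} (hp : 2 ≤ p)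
include hp

lemma FpTerm_congr_of_le {b c d : ℕ} (hc : c ≤ b) (hd : d ≤ c) (X : ℝ) :
    FpTerm p (b + 2) (b + 2) X c d = FpTerm p (b + 2) b X c d := by
  simp only [FpTerm, hirI_congr_of_le hp hc hd]

/-- Only the factors at `j = b + 1, b + 2, b + 3` tell `λ = (b + 2, b + 2)` and `λ = (b + 2, b)`
apart. -/
lemma FpTerm_eq (b β c d : ℕ) (Y : ℝ) :
    FpTerm p (b + 2) β (p * Y) c d =
      ((-(p : ℝ)) ^ d)⁻¹ * Y ^ (c + d) * (-(p : ℝ)) ^ (epsn c + epsn d) *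
        (((∏ j ∈ Finset.Icc 1 b, hirI p (c, d) (b + 2, β) j : ℚ) : ℝ) *
          ((hirI p (c, d) (b + 2, β) (b + 1) * hirI p (c, d) (b + 2, β) (b + 2) *
            hirI p (c, d) (b + 2, β) (b + 3) : ℚ) : ℝ)) := by
  have h0 : (p : ℝ) ≠ 0 := by positivity
  have h : (-1 : ℝ) ^ d * ((p : ℝ) ^ (2 * d + c))⁻¹ * (p * Y) ^ (c + d) =
      ((-(p : ℝ)) ^ d)⁻¹ * Y ^ (c + d) := by
    have hs : (-1 : ℝ) ^ d * (-1) ^ d = 1 := by rw [← mul_pow]; norm_num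
    rw [inv_mul_eq_div, eq_div_iff (pow_ne_zero _ (neg_ne_zero.mpr h0)), neg_pow (p : ℝ) d,
      mul_pow]
    field_simp
    linear_combination ((p : ℝ) ^ (c + 2 * d) * Y ^ (c + d)) * hs
  rw [FpTerm, h, Finset.prod_Icc_succ_top (by omega), Finset.prod_Icc_succ_top (by omega),
    Finset.prod_Icc_succ_top (by omega)]
  push_cast
  ring

lemma sum_FpTerm {b β c : ℕ} (hβ : b ≤ β) (hc : b < c) {Y : ℝ} (hY : Y ≠ 1) {T : ℚ}
    (hT : ∀ d ≤ b, hirI p (c, d) (b + 2, β) (b + 1) * hirI p (c, d) (b + 2, β) (b + 2) *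
      hirI p (c, d) (b + 2, β) (b + 3) = T) :
    ∑ d ∈ Finset.range (b + 1), FpTerm p (b + 2) β (p * Y) c d =
      (-(p : ℝ)) ^ (2 * b) * Y ^ c * -(p : ℝ) *
        (1 + (1 - p) * (Y * ((Y ^ b - 1) / (Y - 1)))) * T := by
  have h0 : (p : ℝ) ≠ 0 := by positivity
  have hc0 : epsn c = 1 := if_neg (by omega)
  rw [Finset.sum_range_succ', FpTerm_eq hp, hT 0 (by omega),
    prod_hirI_zero hp (by simp) (by simpa) hc, ← geom_sum_eq hY, Finset.mul_sum, Finset.mul_sum]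
  have h : ∀ e ∈ Finset.range b, FpTerm p (b + 2) β (p * Y) c (e + 1) =
      (-(p : ℝ)) ^ (2 * b) * Y ^ c * -(p : ℝ) * T * ((1 - p) * (Y * Y ^ e)) := fun e he => by
    rw [Finset.mem_range] at he
    have he0 : epsn (e + 1) = 1 := if_neg (by omega)
    rw [FpTerm_eq hp, hT _ (by omega), prod_hirI_succ hp (by simp) (by simpa) hc
      (by omega), hc0, he0, mul_assoc, mul_assoc, inv_mul_eq_div,
      div_eq_iff (pow_ne_zero _ (neg_ne_zero.mpr h0))]
    push_cast
    ring
  rw [Finset.sum_congr rfl h, ← Finset.mul_sum, hc0]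
  simp only [epsn, if_true]
  push_cast
  ring

lemma FpTerm_add {b β c k : ℕ} (hβ : b ≤ β) (hc : b + 1 + k ≤ c) (Y : ℝ) :
    FpTerm p (b + 2) β (p * Y) c (b + 1 + k) =
      (-(p : ℝ)) ^ (2 * b + 1) * ((-(p : ℝ)) ^ k)⁻¹ * Y ^ (c + (b + 1 + k)) *
        ((hirI p (c, b + 1 + k) (b + 2, β) (b + 1) * hirI p (c, b + 1 + k) (b + 2, β) (b + 2) *
          hirI p (c, b + 1 + k) (b + 2, β) (b + 3) : ℚ) : ℝ) := by
  have h0 : (p : ℝ) ≠ 0 := by positivity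
  have hq := pow_ne_zero k (neg_ne_zero.mpr h0)
  have hq' := pow_ne_zero (b + 1 + k) (neg_ne_zero.mpr h0)
  have hc0 : epsn c = 1 := if_neg (by omega)
  have hd0 : epsn (b + 1 + k) = 1 := if_neg (by omega)
  have h : ((-(p : ℝ)) ^ (b + 1 + k))⁻¹ * (-(p : ℝ)) ^ (1 + 1) * (-(p : ℝ)) ^ (3 * b) =
      (-(p : ℝ)) ^ (2 * b + 1) * ((-(p : ℝ)) ^ k)⁻¹ := by
    rw [mul_assoc, inv_mul_eq_div, ← div_eq_mul_inv, div_eq_div_iff hq' hq]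
    ring
  rw [FpTerm_eq hp, prod_hirI_of_lt hp (by simp) (by simpa) hc (by omega), hc0, hd0, ← h]
  push_cast
  ring

end Terms

theorem statement13 (p : ℕ) (hp : p.Prime) (hodd : Odd p)
    (b : ℕ) (X : ℝ) (hX : X ≠ (p : ℝ)) :
    Fp p (b + 2) (b + 2) X - Fp p (b + 2) b X
      = (X ^ (b + 1) * (X + p) * (X - 1) / (X - p)) *
          (((1 + (p : ℝ) - (p : ℝ) ^ 2) * X - p) * (p : ℝ) ^ (b + 1)
            + (((p : ℝ) ^ 2 - X) / p) * X ^ (b + 3)) := by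
  have hp2 := hp.two_le
  have hp0 : (p : ℝ) ≠ 0 := by exact_mod_cast hp.ne_zero
  obtain ⟨Y, rfl⟩ : ∃ Y, X = p * Y := ⟨X / p, by field_simp⟩
  have hY : Y ≠ 1 := fun h => hX (by rw [h, mul_one])
  have hY' : Y - 1 ≠ 0 := sub_ne_zero.mpr hY
  have hlow : ∑ c ∈ Finset.range (b + 1), ∑ d ∈ Finset.range (min c (b + 2 + 1) + 1),
        FpTerm p (b + 2) (b + 2) (p * Y) c d =
      ∑ c ∈ Finset.range (b + 1), ∑ d ∈ Finset.range (min c (b + 1) + 1),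
        FpTerm p (b + 2) b (p * Y) c d := by
    refine Finset.sum_congr rfl fun c hc => ?_
    rw [Finset.mem_range] at hc
    rw [min_eq_left (by omega), min_eq_left (by omega)]
    refine Finset.sum_congr rfl fun d hd => ?_
    rw [Finset.mem_range] at hd
    exact FpTerm_congr_of_le hp2 (by omega) (by omega) _
  have h1 := sum_FpTerm hp2 (b := b) (β := b + 2) (c := b + 1) (by omega) (by omega) hY
    (T := (1 + (-(p : ℚ))⁻¹) * (1 + (-(p : ℚ)) ^ 2) * 1 * 1) fun d hd => by
      simp (disch := omega) only [hirI_eq_localFactor, dualCt, if_pos, if_neg, Nat.reduceAdd,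
        localFactor_2210 hp2, localFactor_zero_zero hp2]
  have h2 := sum_FpTerm hp2 (b := b) (β := b + 2) (c := b + 2) (by omega) (by omega) hY
    (T := (-(p : ℚ)) ^ 2 * ((1 + (-(p : ℚ))⁻¹) * (1 + (-(p : ℚ)) ^ 2)) * 1) fun d hd => by
      simp (disch := omega) only [hirI_eq_localFactor, dualCt, if_pos, if_neg, Nat.reduceAdd,
        localFactor_2211 hp2, localFactor_2210 hp2, localFactor_zero_zero hp2]
  have h3 := sum_FpTerm hp2 (b := b) (β := b + 2) (c := b + 3) (by omega) (by omega) hY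
    (T := (-(p : ℚ)) ^ 2 * (-(p : ℚ)) ^ 2 * (1 + (-(p : ℚ))⁻¹)) fun d hd => by
      simp (disch := omega) only [hirI_eq_localFactor, dualCt, if_pos, if_neg, Nat.reduceAdd,
        localFactor_2211 hp2, localFactor_0210 hp2]
  have h1' := sum_FpTerm hp2 (b := b) (β := b) (c := b + 1) (by omega) (by omega) hY
    (T := (1 + (-(p : ℚ))⁻¹ + -(p : ℚ)) * 1 * 1) fun d hd => by
      simp (disch := omega) only [hirI_eq_localFactor, dualCt, if_pos, if_neg, Nat.reduceAdd,
        localFactor_1210 hp2, localFactor_zero_zero hp2]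
  have h2' := sum_FpTerm hp2 (b := b) (β := b) (c := b + 2) (by omega) (by omega) hY
    (T := -(p : ℚ) * (1 + -(p : ℚ)) * 1) fun d hd => by
      simp (disch := omega) only [hirI_eq_localFactor, dualCt, if_pos, if_neg, Nat.reduceAdd,
        localFactor_1211 hp2, localFactor_1110 hp2, localFactor_zero_zero hp2]
  have h3' := sum_FpTerm hp2 (b := b) (β := b) (c := b + 3) (by omega) (by omega) hY
    (T := -(p : ℚ) * -(p : ℚ) * 1) fun d hd => by
      simp (disch := omega) only [hirI_eq_localFactor, dualCt, if_pos, if_neg, Nat.reduceAdd,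
        localFactor_1211 hp2, localFactor_1111 hp2, localFactor_0110 hp2]
  rw [Fp_eq_sum_FpTerm, Fp_eq_sum_FpTerm]
  simp only [Finset.sum_range_succ _ (b + 1), Finset.sum_range_succ _ (b + 1 + 1),
    Finset.sum_range_succ _ (b + 1 + 1 + 1), show b + 2 + 2 = b + 1 + 1 + 1 + 1 from rfl, hlow]
  rw [show min (b + 1) (b + 2 + 1) = b + 1 by omega,
    show min (b + 1 + 1) (b + 2 + 1) = b + 1 + 1 by omega,
    show min (b + 1 + 1 + 1) (b + 2 + 1) = b + 1 + 1 + 1 by omega, min_self,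
    show min (b + 1 + 1) (b + 1) = b + 1 by omega,
    show min (b + 1 + 1 + 1) (b + 1) = b + 1 by omega]
  simp only [Finset.sum_range_succ _ (b + 1), Finset.sum_range_succ _ (b + 1 + 1),
    Finset.sum_range_succ _ (b + 1 + 1 + 1)]
  rw [h1, h2, h3, h1', h2', h3']
  rw [FpTerm_add hp2 (b := b) (β := b + 2) (c := b + 1) (k := 0) (by omega) (by omega)]
  rw [FpTerm_add hp2 (b := b) (β := b + 2) (c := b + 2) (k := 0) (by omega) (by omega)]
  rw [FpTerm_add hp2 (b := b) (β := b + 2) (c := b + 2) (k := 1) (by omega) (by omega)]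
  rw [FpTerm_add hp2 (b := b) (β := b + 2) (c := b + 3) (k := 0) (by omega) (by omega)]
  rw [FpTerm_add hp2 (b := b) (β := b + 2) (c := b + 3) (k := 1) (by omega) (by omega)]
  rw [FpTerm_add hp2 (b := b) (β := b + 2) (c := b + 3) (k := 2) (by omega) (by omega)]
  rw [FpTerm_add hp2 (b := b) (β := b) (c := b + 1) (k := 0) (by omega) (by omega)]
  rw [FpTerm_add hp2 (b := b) (β := b) (c := b + 2) (k := 0) (by omega) (by omega)]
  rw [FpTerm_add hp2 (b := b) (β := b) (c := b + 3) (k := 0) (by omega) (by omega)]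
  simp (disch := omega) only [hirI_eq_localFactor, dualCt, if_pos, if_neg, Nat.reduceAdd,
    localFactor_zero_zero hp2, localFactor_2220 hp2, localFactor_2221 hp2, localFactor_2210 hp2,
    localFactor_2222 hp2, localFactor_2211 hp2, localFactor_0210 hp2, localFactor_0220 hp2,
    localFactor_1220 hp2,
    localFactor_1221 hp2, localFactor_1110 hp2, localFactor_1111 hp2, localFactor_0110 hp2]
  have he : (-(p : ℝ)) ^ (2 * b) = (p : ℝ) ^ (2 * b) := (even_two_mul b).neg_pow _
  have hi : (-(p : ℝ))⁻¹ = -(p : ℝ)⁻¹ := inv_neg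
  push_cast
  simp only [pow_succ (-(p : ℝ)) (2 * b), he, hi, pow_zero, inv_one]
  rw [show (p : ℝ) * Y - p = p * (Y - 1) by ring, mul_pow, mul_pow]
  field_simp
  ring
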